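/- arXiv:1610.00526 — 2 statements merged into one kernel-verified Lean document; each statement's English description precedes it below -/
import Mathlib

section
/- Fix reals Ξ > 1, c > -1, Z > 0, and a continuous function ρ : [1,Ξ] → ℝ. For l ∈ ℕ set ρ_l := δ_{l,0}/√Z − (1/2)·∫₁^Ξ ρ(T)·(T+c)^{-(3+2l)/2} dT, assume ρ₀ ≠ 0, set x_r := −(2r+1)!!·ρ_r/((r+1)·ρ₀), and for B ≥ 3, 0 ≤ M ≤ B−3 define γ^M_B := ρ₀^{−(B−3)}·Σ_{K=0}^{B−3−M} ((B−3+K)!/((B−3−M)!·M!))·B_{B−3−M,K}(x₁,…,x_{B−2−M−K}). Define D(t) := 1/√Z − ∫₁^Ξ ρ(T) dT/(√(T+c)·(√(T+c)+√(T+c−2t))·√(T+c−2t)) for real |t| < (1+c)/2, so that D(0) = ρ₀. Then for every B ≥ 3 and 0 ≤ M ≤ B−3: M!·(B−3−M)!·ρ₀^{B−3}·γ^M_B = (B−3)!·ρ₀^{B−2}·(d^{B−3−M}/dt^{B−3−M})[D(t)^{−(B−2)}] evaluated at t = 0. -/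
/-- The partial Bell polynomial `B_{n,k}(x₁,…,x_{n−k+1})`, defined by the explicit sum
`Σ n!/(j₁!⋯j_{n−k+1}!)·∏ᵢ(xᵢ/i!)^{jᵢ}` over nonnegative integers `j₁,…,j_{n−k+1}` with
`j₁+⋯+j_{n−k+1} = k` and `1j₁+2j₂+⋯+(n−k+1)j_{n−k+1} = n`. -/
noncomputable def bellPoly (n k : ℕ) (x : ℕ → ℝ) : ℝ :=
  ∑ j ∈ (Finset.Nat.antidiagonalTuple (n - k + 1) k).filter
      (fun j : Fin (n - k + 1) → ℕ => ∑ i : Fin (n - k + 1), ((i : ℕ) + 1) * j i = n),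
    (n.factorial : ℝ) / (∏ i : Fin (n - k + 1), ((j i).factorial : ℝ)) *
      ∏ i : Fin (n - k + 1), (x ((i : ℕ) + 1) / (((i : ℕ) + 1).factorial : ℝ)) ^ (j i)

/-- The odd double factorial `(2j+1)!! = (2j+1)!/(2^j·j!)` as a real number. -/
noncomputable def df (j : ℕ) : ℝ := ((2 * j + 1).factorial : ℝ) / (2 ^ j * (j.factorial : ℝ))

/-- The coefficients `γ^M_B` built from a sequence `ρ₀, ρ₁, …`:
`γ^M_B = ρ₀^{−(B−3)}·Σ_{K=0}^{B−3−M} ((B−3+K)!/((B−3−M)!·M!))·B_{B−3−M,K}(x₁,…)` with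
`x_r = −(2r+1)!!·ρ_r/((r+1)·ρ₀)`, for `B ≥ 3` and `0 ≤ M ≤ B−3`, and `γ^M_B = 0`
for `M` out of this range. -/
noncomputable def gam (ρs : ℕ → ℝ) (B : ℕ) (M : ℤ) : ℝ :=
  if 3 ≤ B ∧ 0 ≤ M ∧ M ≤ (B : ℤ) - 3 then
    (ρs 0 ^ (B - 3))⁻¹ *
      ∑ K ∈ Finset.range (B - 3 - M.toNat + 1),
        ((B - 3 + K).factorial : ℝ) /
            (((B - 3 - M.toNat).factorial : ℝ) * (M.toNat.factorial : ℝ)) *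
          bellPoly (B - 3 - M.toNat) K (fun r => -(df r * ρs r) / ((r + 1) * ρs 0))
  else 0

open MeasureTheory

/-- The coefficient of `X ^ N` in the `K`-th power of a polynomial of degree at most `N`. -/
theorem coeff_sum_C_mul_X_pow_pow (N K : ℕ) (q : ℕ → ℝ) :
    ((∑ i : Fin (N + 1), Polynomial.C (q i) * Polynomial.X ^ (i : ℕ)) ^ K).coeff N =
      ∑ j ∈ (Finset.Nat.antidiagonalTuple (N + 1) K).filter
          (fun j => ∑ i : Fin (N + 1), (i : ℕ) * j i = N),
        (K.factorial : ℝ) / (∏ i, ((j i).factorial : ℝ)) * ∏ i : Fin (N + 1), q i ^ j i := by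
  rw [Finset.sum_pow_eq_sum_piAntidiag, Finset.piAntidiag_univ_fin_eq_antidiagonalTuple,
    Polynomial.finsetSum_coeff, Finset.sum_filter]
  refine Finset.sum_congr rfl fun j hj => ?_
  have hK : ∑ i, j i = K := Finset.Nat.mem_antidiagonalTuple.1 hj
  have hprod : ∏ i : Fin (N + 1), (Polynomial.C (q i) * Polynomial.X ^ (i : ℕ)) ^ j i =
      Polynomial.C (∏ i : Fin (N + 1), q i ^ j i) *
        Polynomial.X ^ (∑ i : Fin (N + 1), (i : ℕ) * j i) := by
    simp only [mul_pow, Finset.prod_mul_distrib, ← pow_mul, Finset.prod_pow_eq_pow_sum, map_prod,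
      map_pow]
  have hmult : (Nat.multinomial Finset.univ j : ℝ) =
      (K.factorial : ℝ) / (∏ i, ((j i).factorial : ℝ)) := by
    have h := Nat.multinomial_spec Finset.univ j
    rw [hK] at h
    rw [eq_div_iff (Finset.prod_ne_zero_iff.2 fun i _ => by positivity), mul_comm]
    exact_mod_cast h
  rw [hprod, ← Polynomial.C_eq_natCast, ← mul_assoc, ← Polynomial.C_mul,
    Polynomial.coeff_C_mul_X_pow, hmult]
  simp only [eq_comm]

/-- Partial Bell polynomials are the coefficients of powers of an exponential generating series. -/
theorem factorial_mul_bellPoly {n K : ℕ} (hK : K ≤ n) (x : ℕ → ℝ) :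
    (K.factorial : ℝ) * bellPoly n K x = n.factorial * PowerSeries.coeff n
      ((PowerSeries.X * PowerSeries.mk fun r => x (r + 1) / ((r + 1).factorial : ℝ)) ^ K) := by
  obtain ⟨N, rfl⟩ := Nat.exists_eq_add_of_le' hK
  have hcoeff (f : PowerSeries ℝ) : PowerSeries.coeff N (f ^ K) =
      ((PowerSeries.trunc (N + 1) f) ^ K).coeff N := by
    have h := congrArg (Polynomial.coeff · N) (PowerSeries.trunc_trunc_pow f (N + 1) K)
    simp only [PowerSeries.coeff_trunc, Nat.lt_succ_self, if_true] at h
    rw [← h, ← Polynomial.coe_pow, Polynomial.coeff_coe]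
  have htrunc (f : ℕ → ℝ) : PowerSeries.trunc (N + 1) (PowerSeries.mk f) =
      ∑ i : Fin (N + 1), Polynomial.C (f i) * Polynomial.X ^ (i : ℕ) := by
    ext k
    rw [Fin.sum_univ_eq_sum_range (fun i => Polynomial.C (f i) * Polynomial.X ^ i)]
    simp [PowerSeries.coeff_trunc, Polynomial.coeff_X_pow]
  rw [mul_pow, PowerSeries.coeff_X_pow_mul, hcoeff, htrunc,
    coeff_sum_C_mul_X_pow_pow N K (fun r => x (r + 1) / ((r + 1).factorial : ℝ)), bellPoly,
    Nat.add_sub_cancel, Finset.mul_sum, Finset.mul_sum]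
  refine Finset.sum_congr ?_ fun j _ => by ring
  refine Finset.filter_congr fun j hj => ?_
  have hj : ∑ i, j i = K := Finset.Nat.mem_antidiagonalTuple.1 hj
  simp only [add_mul, one_mul, Finset.sum_add_distrib, hj]
  omega

/-- Coefficients of the reciprocal of the `(d+1)`-st power of a power series `c (1 - Q)`. -/
theorem coeff_of_mul_pow_one_sub_eq_one {c : ℝ} {d : ℕ} {R S : PowerSeries ℝ}
    (h : R * (PowerSeries.C c * (1 - PowerSeries.X * S)) ^ (d + 1) = 1) (n : ℕ) :
    c ^ (d + 1) * PowerSeries.coeff n R = ∑ K ∈ Finset.range (n + 1),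
      ((d + K).choose d : ℝ) * PowerSeries.coeff n ((PowerSeries.X * S) ^ K) := by
  have hQ : PowerSeries.HasSubst (PowerSeries.X * S) :=
    PowerSeries.HasSubst.of_constantCoeff_zero' (by simp)
  have hG := congrArg (PowerSeries.subst (PowerSeries.X * S))
    (PowerSeries.mk_add_choose_mul_one_sub_pow_eq_one ℝ d)
  rw [← PowerSeries.coe_substAlgHom hQ, map_mul, map_pow, map_sub, map_one,
    PowerSeries.substAlgHom_X, PowerSeries.coe_substAlgHom hQ] at hG
  have hR : PowerSeries.C (c ^ (d + 1)) * R = PowerSeries.subst (PowerSeries.X * S)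
      (PowerSeries.mk fun n => ((d + n).choose d : ℝ)) := by
    rw [mul_pow, ← map_pow] at h
    linear_combination (PowerSeries.subst (PowerSeries.X * S)
      (PowerSeries.mk fun n => ((d + n).choose d : ℝ))) * h -
      R * PowerSeries.C (c ^ (d + 1)) * hG
  rw [← PowerSeries.coeff_C_mul, hR, PowerSeries.coeff_subst' hQ,
    finsum_eq_sum_of_support_subset (s := Finset.range (n + 1))]
  · simp
  · intro K hK
    by_contra hlt
    refine hK ?_
    simp only [Finset.coe_range, Set.mem_Iio, not_lt] at hlt
    simp [mul_pow, PowerSeries.coeff_X_pow_mul', show ¬ K ≤ n by omega]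

/-- The formal Taylor series at `0` of a real function. -/
noncomputable def taylorSeriesZero (f : ℝ → ℝ) : PowerSeries ℝ :=
  PowerSeries.mk fun n => iteratedDeriv n f 0 / n.factorial

theorem taylorSeriesZero_mul {f g : ℝ → ℝ} (hf : AnalyticAt ℝ f 0) (hg : AnalyticAt ℝ g 0) :
    taylorSeriesZero (f * g) = taylorSeriesZero f * taylorSeriesZero g := by
  ext n
  rw [taylorSeriesZero, PowerSeries.coeff_mk, iteratedDeriv_mul hf.contDiffAt hg.contDiffAt,
    PowerSeries.coeff_mul, Finset.Nat.sum_antidiagonal_eq_sum_range_succ_mk, Finset.sum_div]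
  refine Finset.sum_congr rfl fun i hi => ?_
  rw [Nat.cast_choose ℝ (Finset.mem_range_succ_iff.1 hi)]
  simp only [taylorSeriesZero, PowerSeries.coeff_mk]
  field_simp

theorem taylorSeriesZero_one : taylorSeriesZero 1 = 1 := by
  ext n
  rcases n with _ | n
  · simp [taylorSeriesZero]
  · have : iteratedDeriv (n + 1) (1 : ℝ → ℝ) 0 = 0 := by
      change iteratedDeriv (n + 1) (fun _ : ℝ => (1 : ℝ)) 0 = 0
      simp [iteratedDeriv_const]
    simp [taylorSeriesZero, PowerSeries.coeff_one, this]

theorem taylorSeriesZero_pow {f : ℝ → ℝ} (hf : AnalyticAt ℝ f 0) (m : ℕ) :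
    taylorSeriesZero (f ^ m) = taylorSeriesZero f ^ m := by
  induction m with
  | zero => simp [taylorSeriesZero_one]
  | succ m ih => rw [pow_succ, taylorSeriesZero_mul (hf.pow m) hf, ih, pow_succ]

theorem taylorSeriesZero_inv_mul {f : ℝ → ℝ} (hf : AnalyticAt ℝ f 0) (h0 : f 0 ≠ 0) :
    taylorSeriesZero f⁻¹ * taylorSeriesZero f = 1 := by
  rw [← taylorSeriesZero_mul (hf.inv h0) hf, ← taylorSeriesZero_one]
  have : (f⁻¹ * f) =ᶠ[nhds 0] 1 := by
    filter_upwards [hf.continuousAt.eventually_ne h0] with t ht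
    simp [ht]
  ext n
  simp only [taylorSeriesZero, PowerSeries.coeff_mk, this.iteratedDeriv_eq]

theorem eval_half_ascPochhammer (n : ℕ) :
    (ascPochhammer ℝ n).eval (1 / 2) = ((2 * n).factorial : ℝ) / (4 ^ n * n.factorial) := by
  induction n with
  | zero => simp
  | succ n ih =>
    rw [ascPochhammer_succ_eval, ih, show 2 * (n + 1) = 2 * n + 1 + 1 by ring,
      Nat.factorial_succ, Nat.factorial_succ, Nat.factorial_succ]
    push_cast
    field_simp
    ring

theorem choose_half_add_succ (r : ℕ) :
    Ring.choose (1 / 2 + ((r + 1 : ℕ) : ℝ) - 1) (r + 1) * 2 ^ (r + 1) =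
      df r / ((r + 1).factorial : ℝ) := by
  have h := Ring.factorial_nsmul_multichoose_eq_ascPochhammer (1 / 2 : ℝ) (r + 1)
  rw [Polynomial.ascPochhammer_smeval_eq_eval, eval_half_ascPochhammer, nsmul_eq_mul] at h
  rw [Ring.choose, show (1 / 2 + ((r + 1 : ℕ) : ℝ) - 1 - ((r + 1 : ℕ) : ℝ) + 1) = 1 / 2 by ring,
    eq_div_iff (by positivity), mul_right_comm, mul_comm _ (((r + 1).factorial : ℕ) : ℝ), h, df,
    show 2 * (r + 1) = 2 * r + 1 + 1 by ring, Nat.factorial_succ (2 * r + 1), Nat.factorial_succ r,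
    show (4 : ℝ) = 2 * 2 by norm_num, mul_pow]
  push_cast
  field_simp
  ring

/-- Taylor expansion in `t` of `((a - 2t)^(-1/2) - a^(-1/2)) / (2t)`, in its form regular at `0`. -/
theorem hasSum_kernel {a t : ℝ} (ht : 2 * |t| < a) :
    HasSum (fun r => df r / (2 * ((r + 1).factorial : ℝ)) * (t ^ r / √a ^ (3 + 2 * r)))
      (1 / (√a * (√a + √(a - 2 * t)) * √(a - 2 * t))) := by
  have ha : 0 < a := by linarith [abs_nonneg t]
  have hat : 0 < a - 2 * t := by linarith [le_abs_self t]
  have hsa : 0 < √a := Real.sqrt_pos.2 ha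
  have hsat : 0 < √(a - 2 * t) := Real.sqrt_pos.2 hat
  rcases eq_or_ne t 0 with rfl | ht0
  · convert hasSum_single (0 : ℕ) (fun r hr => ?_) using 1
    · simp [df]
      field_simp
      ring
    · simp [hr]
  have hu : |2 * t / a| < 1 := by
    rw [abs_div, abs_mul, abs_two, abs_of_pos ha, div_lt_one ha]
    exact ht
  have hs := (Real.one_div_one_sub_rpow_hasFPowerSeriesOnBall_zero (1 / 2)).hasSum
    (y := 2 * t / a) (by
      rw [Metric.mem_eball, edist_eq_enorm_sub, sub_zero, ← ENNReal.ofReal_one,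
        Real.enorm_eq_ofReal_abs]
      exact (ENNReal.ofReal_lt_ofReal_iff one_pos).2 hu)
  simp only [FormalMultilinearSeries.ofScalars_apply_eq, smul_eq_mul, zero_add] at hs
  rw [← hasSum_nat_add_iff' 1] at hs
  have hs := hs.mul_left (1 / (2 * t * √a))
  have hsq : √a ^ 2 = a := Real.sq_sqrt ha.le
  have hsqt : √(a - 2 * t) ^ 2 = a - 2 * t := Real.sq_sqrt hat.le
  convert! hs using 1
  · ext r
    have hdf : df r = Ring.choose (1 / 2 + ((r + 1 : ℕ) : ℝ) - 1) (r + 1) * 2 ^ (r + 1) *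
        ((r + 1).factorial : ℝ) := by
      rw [choose_half_add_succ, div_mul_cancel₀ _ (by positivity)]
    have hpow : √a ^ (3 + 2 * r) = √a * a ^ (r + 1) := by
      nth_rw 3 [← hsq]
      ring
    rw [hdf, hpow, div_pow, mul_pow]
    field_simp
    ring
  · rw [← Real.sqrt_eq_rpow, one_sub_div ha.ne', Real.sqrt_div hat.le]
    have h2t : 2 * t = √a ^ 2 - √(a - 2 * t) ^ 2 := by rw [hsq, hsqt]; ring
    have hne : √a - √(a - 2 * t) ≠ 0 := fun h => ht0 (by
      rw [sub_eq_zero.1 h] at h2t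
      linarith)
    have hadd : √a + √(a - 2 * t) ≠ 0 := by positivity
    have hfac : 2 * t * √a = (√a - √(a - 2 * t)) * (√a + √(a - 2 * t)) * √a := by
      linear_combination √a * h2t
    rw [hfac]
    simp
    generalize √(a - 2 * t) = e at *
    field_simp

/-- Term-by-term integration of `hasSum_kernel` against a continuous density. -/
theorem hasSum_integral_kernel {Ξ c : ℝ} (hΞ : 1 < Ξ) (hc : -1 < c) {ρ : ℝ → ℝ}
    (hρ : ContinuousOn ρ (Set.Icc 1 Ξ)) {t : ℝ} (ht : 2 * |t| < 1 + c) :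
    HasSum (fun r => df r / (2 * ((r + 1).factorial : ℝ)) * t ^ r *
        ∫ T in (1 : ℝ)..Ξ, ρ T / √(T + c) ^ (3 + 2 * r))
      (∫ T in (1 : ℝ)..Ξ, ρ T / (√(T + c) * (√(T + c) + √(T + c - 2 * t)) *
        √(T + c - 2 * t))) := by
  obtain ⟨C, hC⟩ := isCompact_Icc.exists_bound_of_continuousOn hρ
  have hmem {T : ℝ} (hT : T ∈ Set.uIoc 1 Ξ) : T ∈ Set.Icc 1 Ξ := by
    rw [Set.uIoc_of_le hΞ.le] at hT
    exact Set.Ioc_subset_Icc_self hT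
  have hdf (r : ℕ) : 0 ≤ df r := by unfold df; positivity
  have hbound : HasSum (fun r => C * (df r / (2 * ((r + 1).factorial : ℝ)) *
      (|t| ^ r / √(1 + c) ^ (3 + 2 * r)))) _ :=
    (hasSum_kernel (a := 1 + c) (t := |t|) (by rwa [abs_abs])).mul_left C
  have hs := intervalIntegral.hasSum_integral_of_dominated_convergence (μ := volume)
    (a := (1 : ℝ)) (b := Ξ)
    (F := fun r T => df r / (2 * ((r + 1).factorial : ℝ)) * t ^ r *
      (ρ T / √(T + c) ^ (3 + 2 * r)))
    (f := fun T => ρ T / (√(T + c) * (√(T + c) + √(T + c - 2 * t)) * √(T + c - 2 * t)))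
    (fun r _ => C * (df r / (2 * ((r + 1).factorial : ℝ)) *
      (|t| ^ r / √(1 + c) ^ (3 + 2 * r)))) ?_ ?_ ?_ ?_ ?_
  · simpa only [intervalIntegral.integral_const_mul] using hs
  · intro r
    refine ContinuousOn.aestronglyMeasurable ?_ measurableSet_uIoc
    refine continuousOn_const.mul ((hρ.mono fun T => hmem).div (by fun_prop) fun T hT => ?_)
    have : 0 < T + c := by linarith [(hmem hT).1]
    positivity
  · refine fun r => Filter.Eventually.of_forall fun T hT => ?_
    have h1 : 1 + c ≤ T + c := by linarith [(hmem hT).1]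
    have h0 : 0 < √(1 + c) := Real.sqrt_pos.2 (by linarith)
    have hle : √(1 + c) ≤ √(T + c) := Real.sqrt_le_sqrt h1
    have hd : 0 ≤ df r / (2 * ((r + 1).factorial : ℝ)) := div_nonneg (hdf r) (by positivity)
    have hρT := hC T (hmem hT)
    rw [norm_mul, norm_mul, norm_div (ρ T), norm_pow, norm_pow, Real.norm_of_nonneg hd,
      Real.norm_of_nonneg (Real.sqrt_nonneg (T + c)), Real.norm_eq_abs t]
    calc _ ≤ df r / (2 * ((r + 1).factorial : ℝ)) * |t| ^ r * (C / √(1 + c) ^ (3 + 2 * r)) := by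
          gcongr
          exact (norm_nonneg _).trans hρT
      _ = _ := by ring
  · exact Filter.Eventually.of_forall fun T _ => hbound.summable
  · exact intervalIntegrable_const
  · refine Filter.Eventually.of_forall fun T hT => ?_
    convert! (hasSum_kernel (a := T + c) (t := t) (by linarith [(hmem hT).1])).mul_left (ρ T) using 1
    · ext r
      ring
    · ring

theorem hasFPowerSeriesAt_of_eventually_hasSum {f : ℝ → ℝ} {d : ℕ → ℝ}
    (h : ∀ᶠ t in nhds 0, HasSum (fun r => d r * t ^ r) (f t)) :
    HasFPowerSeriesAt f (FormalMultilinearSeries.ofScalars ℝ d) 0 := by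
  rw [hasFPowerSeriesAt_iff]
  filter_upwards [h] with t ht
  simpa [FormalMultilinearSeries.coeff_ofScalars, mul_comm] using ht

theorem taylorSeriesZero_eq_mk {f : ℝ → ℝ} {d : ℕ → ℝ}
    (h : HasFPowerSeriesAt f (FormalMultilinearSeries.ofScalars ℝ d) 0) :
    taylorSeriesZero f = PowerSeries.mk d := by
  have := h.analyticAt.hasFPowerSeriesAt.eq_formalMultilinearSeries h
  ext n
  have := congrArg (fun p => FormalMultilinearSeries.coeff p n) this
  simpa [FormalMultilinearSeries.coeff_ofScalars, taylorSeriesZero] using this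

/-- Derivatives at `0` of a negative power, in terms of partial Bell polynomials. -/
theorem pow_mul_iteratedDeriv_inv_pow {f : ℝ → ℝ} (hf : AnalyticAt ℝ f 0) {c : ℝ} (hc : c ≠ 0)
    {x : ℕ → ℝ} (h0 : f 0 = c)
    (hx : ∀ r, iteratedDeriv (r + 1) f 0 = -(c * x (r + 1))) (n d : ℕ) :
    (d.factorial : ℝ) * c ^ (d + 1) * iteratedDeriv n (fun t => (f t ^ (d + 1))⁻¹) 0 =
      ∑ K ∈ Finset.range (n + 1), ((d + K).factorial : ℝ) * bellPoly n K x := by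
  have hT : taylorSeriesZero f = PowerSeries.C c * (1 - PowerSeries.X *
      PowerSeries.mk fun r => x (r + 1) / ((r + 1).factorial : ℝ)) := by
    ext (_ | r)
    · simp [taylorSeriesZero, h0]
    · rw [PowerSeries.coeff_C_mul, map_sub, PowerSeries.coeff_succ_X_mul]
      simp [taylorSeriesZero, hx, PowerSeries.coeff_one]
      ring
  have hinv := taylorSeriesZero_inv_mul (hf.pow (d + 1)) (pow_ne_zero _ (h0 ▸ hc))
  rw [taylorSeriesZero_pow hf, hT] at hinv
  have hcoeff := coeff_of_mul_pow_one_sub_eq_one hinv n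
  have hfun : (fun t => (f t ^ (d + 1))⁻¹) = (f ^ (d + 1))⁻¹ := rfl
  rw [taylorSeriesZero, PowerSeries.coeff_mk, mul_div_assoc', div_eq_iff (by positivity)] at hcoeff
  rw [hfun, mul_assoc, hcoeff, Finset.sum_mul, Finset.mul_sum]
  refine Finset.sum_congr rfl fun K hK => ?_
  have hbell := factorial_mul_bellPoly (Finset.mem_range_succ_iff.1 hK) x
  have hchoose : ((d + K).factorial : ℝ) = (d + K).choose d * d.factorial * K.factorial := by
    exact_mod_cast (by
      rw [Nat.choose_symm_add, Nat.add_choose_mul_factorial_mul_factorial] :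
        (d + K).factorial = (d + K).choose d * d.factorial * K.factorial)
  rw [hchoose]
  linear_combination -((d + K).choose d * d.factorial : ℝ) * hbell

/-- Closed generating-function form of the coefficients `γ^M_B`:
`M!(B−3−M)!·ρ₀^{B−3}·γ^M_B = (B−3)!·ρ₀^{B−2}·(d^{B−3−M}/dt^{B−3−M})[D(t)^{−(B−2)}]|_{t=0}`,
where `ρ_l = δ_{l,0}/√Z − (1/2)∫₁^Ξ ρ(T)(T+c)^{−(3+2l)/2} dT` and
`D(t) = 1/√Z − ∫₁^Ξ ρ(T) dT/(√(T+c)(√(T+c)+√(T+c−2t))√(T+c−2t))`. -/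
theorem stmt_17 (Ξ c Z : ℝ) (hΞ : 1 < Ξ) (hc : -1 < c) (hZ : 0 < Z)
    (ρ : ℝ → ℝ) (hρ : ContinuousOn ρ (Set.Icc 1 Ξ))
    (ρl : ℕ → ℝ)
    (hρl : ∀ l, ρl l = (if l = 0 then 1 / Real.sqrt Z else 0) -
      (1 / 2) * ∫ T in (1 : ℝ)..Ξ, ρ T / Real.sqrt (T + c) ^ (3 + 2 * l))
    (hρ0 : ρl 0 ≠ 0)
    (D : ℝ → ℝ)
    (hD : ∀ t, D t = 1 / Real.sqrt Z - ∫ T in (1 : ℝ)..Ξ,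
      ρ T / (Real.sqrt (T + c) * (Real.sqrt (T + c) + Real.sqrt (T + c - 2 * t)) *
        Real.sqrt (T + c - 2 * t)))
    (B M : ℕ) (hB : 3 ≤ B) (hM : M ≤ B - 3) :
    (M.factorial : ℝ) * ((B - 3 - M).factorial : ℝ) * ρl 0 ^ (B - 3) * gam ρl B (M : ℤ) =
      ((B - 3).factorial : ℝ) * ρl 0 ^ (B - 2) *
        iteratedDeriv (B - 3 - M) (fun t => (D t ^ (B - 2))⁻¹) 0 := by
  obtain ⟨d, rfl⟩ := Nat.exists_eq_add_of_le' hB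
  rw [Nat.add_sub_cancel] at hM
  have hDs : ∀ᶠ t in nhds 0, HasSum (fun r => df r / ((r + 1).factorial : ℝ) * ρl r * t ^ r)
      (D t) := by
    have hev : ∀ᶠ t : ℝ in nhds 0, 2 * |t| < 1 + c :=
      ContinuousAt.eventually_lt (by fun_prop) continuousAt_const (by simp; linarith)
    filter_upwards [hev] with t ht
    rw [hD]
    convert! (hasSum_ite_eq (0 : ℕ) (1 / √Z)).sub (hasSum_integral_kernel hΞ hc hρ ht) using 1
    ext r
    rw [hρl]
    rcases r with _ | r
    · simp [df]
    · simp
      field_simp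
  have hps := hasFPowerSeriesAt_of_eventually_hasSum hDs
  have hder (r : ℕ) : iteratedDeriv r D 0 =
      r.factorial * (df r / ((r + 1).factorial : ℝ) * ρl r) := by
    have := congrArg (PowerSeries.coeff r) (taylorSeriesZero_eq_mk hps)
    rw [taylorSeriesZero, PowerSeries.coeff_mk, PowerSeries.coeff_mk] at this
    rw [← this]
    field_simp
  have hD0 : D 0 = ρl 0 := by simpa [df] using hder 0
  have key := pow_mul_iteratedDeriv_inv_pow hps.analyticAt hρ0
    (x := fun r => -(df r * ρl r) / ((r + 1) * ρl 0)) hD0 (fun r => by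
      rw [hder, Nat.factorial_succ (r + 1)]
      push_cast
      field_simp) (d - M) d
  simp only [Nat.add_sub_cancel, show d + 3 - 2 = d + 1 by omega]
  rw [key, gam, if_pos ⟨by omega, by omega, by push_cast; omega⟩]
  simp only [Nat.add_sub_cancel, Int.toNat_natCast]
  rw [mul_assoc, mul_inv_cancel_left₀ (pow_ne_zero _ hρ0), Finset.mul_sum]
  refine Finset.sum_congr rfl fun K _ => ?_
  generalize bellPoly _ _ _ = b
  field_simp
end

section
/- Fix reals Ξ > 1, c > -1, Z > 0, ν, λ, a continuous function ρ : [1,Ξ] → ℝ with ρ₀ := 1/√Z − (1/2)·∫₁^Ξ ρ(T)·(T+c)^{-3/2} dT ≠ 0, and define W(X) := √(X+c)/√Z − ν + (1/2)·∫₁^Ξ ρ(T) dT /((√(X+c)+√(T+c))·√(T+c)) and, for l ∈ ℕ, ρ_l := δ_{l,0}/√Z − (1/2)·∫₁^Ξ ρ(T)·(T+c)^{-(3+2l)/2} dT. Let B ≥ 3, let γ⁰, …, γ^{B−3} be arbitrary reals, and for reals X¹,…,X^B ≥ 1 define G(X¹|…|X^B) := ((−2λ)^{3B−4}/ρ₀)·Σ_{M=0}^{B−3}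 γ^M · (d^M/dt^M)[Π_{β=1}^B (X^β+c−2t)^{−3/2}] evaluated at t = 0. Then for all X¹,…,X^B ≥ 1: (W(X¹)+ν)·G(X¹|X²|…|X^B) + (1/2)·∫₁^Ξ ρ(T)·(G(X¹|X²|…|X^B) − G(T|X²|…|X^B))/(X¹−T) dT = ((−2λ)^{3B−4}/ρ₀)·Σ_{M=0}^{B−3} γ^M · Σ_{j=0}^{M} C(M,j) · Σ_{l=0}^{j} (2j+1)!!·ρ_{j−l}·(X¹+c)^{−(l+1)} · (d^{M−j}/dt^{M−j})[Π_{β=2}^B (X^β+c−2t)^{−3/2}] evaluated at t = 0, where the integrand is extended continuously to T = X¹, C(M,j) is the binomial coefficient, and (2j+1)!! := (2j+1)!/(2^j·j!). -/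
open MeasureTheory

lemma df_zero : df 0 = 1 := by simp [df]

lemma df_succ (j : ℕ) : df (j + 1) = (2 * j + 3) * df j := by
  have h : (2 * (j + 1) + 1).factorial = (2 * j + 3) * ((2 * j + 2) * (2 * j + 1).factorial) := rfl
  simp only [df, h, Nat.factorial_succ j]
  push_cast
  have := Nat.factorial_ne_zero j
  rw [pow_succ]
  field_simp

lemma hasDerivAt_inv_sqrt_pow (a : ℝ) (n : ℕ) {t : ℝ} (ht : 0 < a - 2 * t) :
    HasDerivAt (fun s => (Real.sqrt (a - 2 * s) ^ n)⁻¹)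
      (n * (Real.sqrt (a - 2 * t) ^ (n + 2))⁻¹) t := by
  have h1 : HasDerivAt (fun s : ℝ => a - 2 * s) (-2) t := by
    simpa using ((hasDerivAt_id t).const_mul 2).const_sub a
  have hs : 0 < Real.sqrt (a - 2 * t) := Real.sqrt_pos.2 ht
  have h2 := ((h1.sqrt ht.ne').fun_pow n).fun_inv (by positivity)
  refine h2.congr_deriv ?_
  rcases n with _ | n
  · simp
  · simp only [Nat.add_sub_cancel]
    field_simp
    ring

lemma iteratedDeriv_inv_sqrt_pow_three (a : ℝ) (j : ℕ) {t : ℝ} (ht : 0 < a - 2 * t) :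
    iteratedDeriv j (fun s => (Real.sqrt (a - 2 * s) ^ 3)⁻¹) t =
      df j * (Real.sqrt (a - 2 * t) ^ (2 * j + 3))⁻¹ := by
  induction j generalizing t with
  | zero => simp [df_zero]
  | succ j ih =>
    have hev : iteratedDeriv j (fun s => (Real.sqrt (a - 2 * s) ^ 3)⁻¹) =ᶠ[nhds t]
        fun s => df j * (Real.sqrt (a - 2 * s) ^ (2 * j + 3))⁻¹ := by
      have hc : ContinuousAt (fun s : ℝ => a - 2 * s) t := by fun_prop
      filter_upwards [hc.eventually (lt_mem_nhds ht)] with s hs using ih hs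
    rw [iteratedDeriv_succ, hev.deriv_eq,
      ((hasDerivAt_inv_sqrt_pow a (2 * j + 3) ht).const_mul (df j)).deriv, df_succ]
    push_cast
    ring

lemma contDiffAt_inv_sqrt_pow (a : ℝ) (n : ℕ) {N : WithTop ℕ∞} {t : ℝ} (ht : 0 < a - 2 * t) :
    ContDiffAt ℝ N (fun s => (Real.sqrt (a - 2 * s) ^ n)⁻¹) t := by
  have hs : 0 < Real.sqrt (a - 2 * t) := Real.sqrt_pos.2 ht
  have h : ContDiffAt ℝ N (fun s : ℝ => a - 2 * s) t := by fun_prop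
  exact ((h.sqrt ht.ne').pow n).inv (by positivity)

/-- Leibniz rule for the product `∏ β, (X β + c - 2 t) ^ (-3/2)`, one factor split off. -/
lemma iteratedDeriv_prod_inv_sqrt_pow_three {ι : Type*} [Fintype ι] [DecidableEq ι] (c : ℝ)
    (X : ι → ℝ) (hX : ∀ β, 0 < X β + c) (i : ι) (M : ℕ) :
    iteratedDeriv M (fun t => ∏ β, (Real.sqrt (X β + c - 2 * t) ^ 3)⁻¹) 0 =
      ∑ j ∈ Finset.range (M + 1), (M.choose j : ℝ) *
        (df j * (Real.sqrt (X i + c) ^ (2 * j + 3))⁻¹) *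
        iteratedDeriv (M - j)
          (fun t => ∏ β ∈ Finset.univ.erase i, (Real.sqrt (X β + c - 2 * t) ^ 3)⁻¹) 0 := by
  have hX' : ∀ β, 0 < X β + c - 2 * 0 := by simpa using hX
  have h : (fun t => ∏ β, (Real.sqrt (X β + c - 2 * t) ^ 3)⁻¹) =
      fun t => (Real.sqrt (X i + c - 2 * t) ^ 3)⁻¹ *
        ∏ β ∈ Finset.univ.erase i, (Real.sqrt (X β + c - 2 * t) ^ 3)⁻¹ := by
    funext t
    exact (Finset.mul_prod_erase _ (fun β => (Real.sqrt (X β + c - 2 * t) ^ 3)⁻¹)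
      (Finset.mem_univ i)).symm
  rw [h, iteratedDeriv_fun_mul (contDiffAt_inv_sqrt_pow _ _ (hX' i))
    (contDiffAt_prod fun β _ => contDiffAt_inv_sqrt_pow _ _ (hX' β))]
  simp only [iteratedDeriv_inv_sqrt_pow_three _ _ (hX' i), mul_zero, sub_zero]

/-- The difference quotient of `u ↦ u ^ (-(2j+3)/2)` between `u = x ^ 2` and `u = y ^ 2`, written
without its removable singularity at `x = y`. -/
noncomputable def invPowSlope (j : ℕ) (x y : ℝ) : ℝ :=
  -((((x + y) * y)⁻¹ * (x ^ (2 * j + 3))⁻¹) +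
    ∑ l ∈ Finset.range (j + 1), (y ^ (3 + 2 * (j - l)))⁻¹ * ((x ^ 2) ^ (l + 1))⁻¹)

lemma mul_sum_inv_pow (j : ℕ) {x y : ℝ} (hx : x ≠ 0) (hy : y ≠ 0) :
    (x ^ 2 - y ^ 2) *
        ∑ l ∈ Finset.range (j + 1), (y ^ (3 + 2 * (j - l)))⁻¹ * ((x ^ 2) ^ (l + 1))⁻¹ =
      (y ^ (2 * j + 3))⁻¹ - y⁻¹ * (x ^ (2 * j + 2))⁻¹ := by
  induction j with
  | zero =>
    simp
    field_simp
  | succ j ih =>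
    have h : ∑ l ∈ Finset.range (j + 1),
          (y ^ (3 + 2 * (j + 1 - (l + 1))))⁻¹ * ((x ^ 2) ^ (l + 1 + 1))⁻¹ =
        (x ^ 2)⁻¹ * ∑ l ∈ Finset.range (j + 1),
          (y ^ (3 + 2 * (j - l)))⁻¹ * ((x ^ 2) ^ (l + 1))⁻¹ := by
      rw [Finset.mul_sum]
      refine Finset.sum_congr rfl fun l _ => ?_
      rw [Nat.add_sub_add_right, pow_succ _ (l + 1), mul_inv]
      ring
    rw [Finset.sum_range_succ', h, mul_add, mul_left_comm, ih]
    simp only [Nat.sub_zero]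
    field_simp
    ring

lemma invPowSlope_eq (j : ℕ) {x y : ℝ} (hx : 0 < x) (hy : 0 < y) (h : x ^ 2 - y ^ 2 ≠ 0) :
    invPowSlope j x y =
      ((x ^ (2 * j + 3))⁻¹ - (y ^ (2 * j + 3))⁻¹) / (x ^ 2 - y ^ 2) := by
  have hs := mul_sum_inv_pow j hx.ne' hy.ne'
  have hxy : (x ^ 2 - y ^ 2) * (((x + y) * y)⁻¹ * (x ^ (2 * j + 3))⁻¹) =
      y⁻¹ * (x ^ (2 * j + 2))⁻¹ - (x ^ (2 * j + 3))⁻¹ := by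
    field_simp
    ring
  rw [eq_div_iff h, invPowSlope]
  linear_combination -hs - hxy

lemma continuousOn_invPowSlope_sqrt {Ξ c x : ℝ} (hc : -1 < c) (hx : 0 < x) (j : ℕ) :
    ContinuousOn (fun T => invPowSlope j x (Real.sqrt (T + c))) (Set.Icc 1 Ξ) := by
  have hs : ∀ T ∈ Set.Icc 1 Ξ, 0 < Real.sqrt (T + c) := fun T hT =>
    Real.sqrt_pos.2 (by linarith [hT.1])
  have hcont : ContinuousOn (fun T => Real.sqrt (T + c)) (Set.Icc 1 Ξ) := by fun_prop
  unfold invPowSlope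
  refine ((ContinuousOn.mul (ContinuousOn.inv₀ (by fun_prop) fun T hT => ?_) (by fun_prop)).add
    (continuousOn_finsetSum _ fun l _ =>
      (ContinuousOn.inv₀ (by fun_prop) fun T hT => ?_).mul (by fun_prop))).neg
  all_goals
    have := hs T hT
    positivity

lemma intervalIntegrable_fun_sum {ι : Type*} (s : Finset ι) {f : ι → ℝ → ℝ} {a b : ℝ}
    (h : ∀ i ∈ s, IntervalIntegrable (f i) volume a b) :
    IntervalIntegrable (fun t => ∑ i ∈ s, f i t) volume a b := by
  simpa only [← Finset.sum_apply] using IntervalIntegrable.sum s h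

/-- Action of the Schwinger–Dyson operator on a single power `(X + c) ^ (-(2j+3)/2)`, with
`x = √(X + c)` and `z = √Z`. -/
lemma schwingerDyson_inv_pow {Ξ c x z : ℝ} (hΞ : 1 ≤ Ξ) (hc : -1 < c) (hx : 0 < x)
    {ρ : ℝ → ℝ} (hρ : ContinuousOn ρ (Set.Icc 1 Ξ)) {ρl : ℕ → ℝ}
    (hρl : ∀ l, ρl l = (if l = 0 then 1 / z else 0) -
      (1 / 2) * ∫ T in (1 : ℝ)..Ξ, ρ T / Real.sqrt (T + c) ^ (3 + 2 * l)) (j : ℕ) :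
    (x / z + (1 / 2) * ∫ T in (1 : ℝ)..Ξ, ρ T / ((x + Real.sqrt (T + c)) * Real.sqrt (T + c))) *
          (x ^ (2 * j + 3))⁻¹ +
        (1 / 2) * ∫ T in (1 : ℝ)..Ξ, ρ T * invPowSlope j x (Real.sqrt (T + c)) =
      ∑ l ∈ Finset.range (j + 1), ρl (j - l) * ((x ^ 2) ^ (l + 1))⁻¹ := by
  have hs : ∀ T ∈ Set.Icc 1 Ξ, 0 < Real.sqrt (T + c) := fun T hT =>
    Real.sqrt_pos.2 (by linarith [hT.1])
  have hcont : ContinuousOn (fun T => Real.sqrt (T + c)) (Set.Icc 1 Ξ) := by fun_prop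
  have hint : ∀ {f : ℝ → ℝ}, ContinuousOn f (Set.Icc 1 Ξ) →
      IntervalIntegrable f volume 1 Ξ := fun hf =>
    (hf.mono (by rw [Set.uIcc_of_le hΞ])).intervalIntegrable
  have hA : IntervalIntegrable (fun T => ρ T / ((x + Real.sqrt (T + c)) * Real.sqrt (T + c)))
      volume 1 Ξ := hint <| hρ.div (by fun_prop) fun T hT => by
    have := hs T hT
    positivity
  have hB : ∀ k, IntervalIntegrable (fun T => ρ T / Real.sqrt (T + c) ^ k) volume 1 Ξ :=
    fun k => hint <| hρ.div (by fun_prop) fun T hT => by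
      have := hs T hT
      positivity
  have hI : ∫ T in (1 : ℝ)..Ξ, ρ T * invPowSlope j x (Real.sqrt (T + c)) =
      -((∫ T in (1 : ℝ)..Ξ, ρ T / ((x + Real.sqrt (T + c)) * Real.sqrt (T + c))) *
          (x ^ (2 * j + 3))⁻¹ +
        ∑ l ∈ Finset.range (j + 1),
          (∫ T in (1 : ℝ)..Ξ, ρ T / Real.sqrt (T + c) ^ (3 + 2 * (j - l))) *
            ((x ^ 2) ^ (l + 1))⁻¹) := by
    simp only [← intervalIntegral.integral_mul_const]
    rw [← intervalIntegral.integral_finsetSum fun l _ => (hB _).mul_const _,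
      ← intervalIntegral.integral_add (hA.mul_const _)
        (intervalIntegrable_fun_sum _ fun l _ => (hB _).mul_const _),
      ← intervalIntegral.integral_neg]
    congr 1
    funext T
    simp only [invPowSlope, mul_neg, mul_add, Finset.mul_sum, div_eq_mul_inv, mul_assoc]
  have hz : ∑ l ∈ Finset.range (j + 1), (if j - l = 0 then 1 / z else 0) * ((x ^ 2) ^ (l + 1))⁻¹ =
      x / z * (x ^ (2 * j + 3))⁻¹ := by
    rw [Finset.sum_eq_single_of_mem j (by simp)]
    · simp
      field_simp
      ring
    · intro l hl hne
      rw [Finset.mem_range] at hl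
      rw [if_neg (by omega), zero_mul]
  simp only [hρl, sub_mul, Finset.sum_sub_distrib, hz, hI, mul_assoc]
  rw [← Finset.mul_sum]
  ring

/-- Action of the Schwinger–Dyson operator `W(X¹)+ν` plus singular integral on the factorised
ansatz `G(X¹|…|X^B) = ((−2λ)^{3B−4}/ρ₀)·Σ_M γ^M·(d^M/dt^M)[Π_β(X^β+c−2t)^{−3/2}]|_{t=0}`:
`(W(X¹)+ν)G(X¹|…|X^B) + (1/2)∫₁^Ξ ρ(T)(G(X¹|…) − G(T|…))/(X¹−T) dT
 = ((−2λ)^{3B−4}/ρ₀)·Σ_M γ^M Σ_j C(M,j) Σ_l (2j+1)!!·ρ_{j−l}·(X¹+c)^{−(l+1)}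
   ·(d^{M−j}/dt^{M−j})[Π_{β≥2}(X^β+c−2t)^{−3/2}]|_{t=0}`,
the integrand being extended continuously to `T = X¹`. -/
theorem stmt_18 (Ξ c Z ν lam : ℝ) (hΞ : 1 < Ξ) (hc : -1 < c) (hZ : 0 < Z)
    (ρ : ℝ → ℝ) (hρ : ContinuousOn ρ (Set.Icc 1 Ξ))
    (W : ℝ → ℝ)
    (hW : ∀ X, W X = Real.sqrt (X + c) / Real.sqrt Z - ν +
      (1 / 2) * ∫ T in (1 : ℝ)..Ξ,
        ρ T / ((Real.sqrt (X + c) + Real.sqrt (T + c)) * Real.sqrt (T + c)))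
    (ρl : ℕ → ℝ)
    (hρl : ∀ l, ρl l = (if l = 0 then 1 / Real.sqrt Z else 0) -
      (1 / 2) * ∫ T in (1 : ℝ)..Ξ, ρ T / Real.sqrt (T + c) ^ (3 + 2 * l))
    (hρ0 : ρl 0 ≠ 0)
    (B : ℕ) (hB : 3 ≤ B) (γ : ℕ → ℝ)
    (G : (Fin B → ℝ) → ℝ)
    (hG : ∀ X : Fin B → ℝ, G X = ((-2 * lam) ^ (3 * B - 4) / ρl 0) *
      ∑ M ∈ Finset.range (B - 3 + 1), γ M *
        iteratedDeriv M (fun t => ∏ β, (Real.sqrt (X β + c - 2 * t) ^ 3)⁻¹) 0) :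
    ∀ X : Fin B → ℝ, (∀ β, 1 ≤ X β) →
      ∃ F : ℝ → ℝ, ContinuousOn F (Set.Icc 1 Ξ) ∧
        (∀ T ∈ Set.Icc 1 Ξ, T ≠ X ⟨0, by omega⟩ →
          F T = ρ T * (G X - G (Function.update X ⟨0, by omega⟩ T)) /
            (X ⟨0, by omega⟩ - T)) ∧
        (W (X ⟨0, by omega⟩) + ν) * G X + (1 / 2) * ∫ T in (1 : ℝ)..Ξ, F T =
          ((-2 * lam) ^ (3 * B - 4) / ρl 0) *
            ∑ M ∈ Finset.range (B - 3 + 1), γ M *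
              ∑ j ∈ Finset.range (M + 1), ((M.choose j : ℕ) : ℝ) *
                ∑ l ∈ Finset.range (j + 1),
                  df j * ρl (j - l) * ((X ⟨0, by omega⟩ + c) ^ (l + 1))⁻¹ *
                    iteratedDeriv (M - j)
                      (fun t => ∏ β ∈ Finset.univ.erase ⟨0, by omega⟩,
                        (Real.sqrt (X β + c - 2 * t) ^ 3)⁻¹) 0 := by
  intro X hX
  have hpos : ∀ β, 0 < X β + c := fun β => by linarith [hX β]
  set i : Fin B := ⟨0, by omega⟩
  set x := Real.sqrt (X i + c) with hx_def
  have hx : 0 < x := Real.sqrt_pos.2 (hpos i)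
  have hx2 : x ^ 2 = X i + c := Real.sq_sqrt (hpos i).le
  set K := (-2 * lam) ^ (3 * B - 4) / ρl 0
  set H : ℕ → ℝ := fun m => iteratedDeriv m
    (fun t => ∏ β ∈ Finset.univ.erase i, (Real.sqrt (X β + c - 2 * t) ^ 3)⁻¹) 0
  have hGX : G X = ∑ M ∈ Finset.range (B - 3 + 1), ∑ j ∈ Finset.range (M + 1),
      K * γ M * (M.choose j : ℝ) * df j * H (M - j) * (x ^ (2 * j + 3))⁻¹ := by
    rw [hG, Finset.mul_sum]
    refine Finset.sum_congr rfl fun M _ => ?_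
    rw [iteratedDeriv_prod_inv_sqrt_pow_three c X hpos i, Finset.mul_sum, Finset.mul_sum]
    refine Finset.sum_congr rfl fun j _ => ?_
    ring
  have hGT : ∀ T, 1 ≤ T → G (Function.update X i T) =
      ∑ M ∈ Finset.range (B - 3 + 1), ∑ j ∈ Finset.range (M + 1),
        K * γ M * (M.choose j : ℝ) * df j * H (M - j) *
          (Real.sqrt (T + c) ^ (2 * j + 3))⁻¹ := by
    intro T hT
    have hpos' : ∀ β, 0 < Function.update X i T β + c := fun β => by
      rcases eq_or_ne β i with rfl | h
      · rw [Function.update_self]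
        linarith
      · rw [Function.update_of_ne h]
        exact hpos β
    have herase : (fun t => ∏ β ∈ Finset.univ.erase i,
          (Real.sqrt (Function.update X i T β + c - 2 * t) ^ 3)⁻¹) =
        fun t => ∏ β ∈ Finset.univ.erase i, (Real.sqrt (X β + c - 2 * t) ^ 3)⁻¹ := by
      funext t
      refine Finset.prod_congr rfl fun β hβ => ?_
      rw [Function.update_of_ne (Finset.ne_of_mem_erase hβ)]
    rw [hG, Finset.mul_sum]
    refine Finset.sum_congr rfl fun M _ => ?_
    rw [iteratedDeriv_prod_inv_sqrt_pow_three c _ hpos' i, herase, Function.update_self,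
      Finset.mul_sum, Finset.mul_sum]
    refine Finset.sum_congr rfl fun j _ => ?_
    ring
  have hcont : ∀ j, ContinuousOn (fun T => ρ T * invPowSlope j x (Real.sqrt (T + c)))
      (Set.Icc 1 Ξ) := fun j => hρ.mul (continuousOn_invPowSlope_sqrt hc hx j)
  have hint : ∀ j, IntervalIntegrable (fun T => ρ T * invPowSlope j x (Real.sqrt (T + c)))
      volume 1 Ξ := fun j =>
    ((hcont j).mono (by rw [Set.uIcc_of_le hΞ.le])).intervalIntegrable
  refine ⟨fun T => ∑ M ∈ Finset.range (B - 3 + 1), ∑ j ∈ Finset.range (M + 1),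
      K * γ M * (M.choose j : ℝ) * df j * H (M - j) *
        (ρ T * invPowSlope j x (Real.sqrt (T + c))), ?_, ?_, ?_⟩
  · exact continuousOn_finsetSum _ fun M _ => continuousOn_finsetSum _ fun j _ =>
      continuousOn_const.mul (hcont j)
  · intro T hT hne
    have hTc : 0 < T + c := by linarith [hT.1]
    have hdiff : x ^ 2 - Real.sqrt (T + c) ^ 2 = X i - T := by
      rw [hx2, Real.sq_sqrt hTc.le]
      ring
    have hne' : x ^ 2 - Real.sqrt (T + c) ^ 2 ≠ 0 := by
      rw [hdiff]
      exact sub_ne_zero.2 hne.symm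
    rw [hGX, hGT T hT.1]
    simp only [← Finset.sum_sub_distrib, Finset.mul_sum, Finset.sum_div]
    refine Finset.sum_congr rfl fun M _ => Finset.sum_congr rfl fun j _ => ?_
    rw [invPowSlope_eq j hx (Real.sqrt_pos.2 hTc) hne', hdiff]
    ring
  · have hI : ∫ T in (1 : ℝ)..Ξ, (∑ M ∈ Finset.range (B - 3 + 1), ∑ j ∈ Finset.range (M + 1),
          K * γ M * (M.choose j : ℝ) * df j * H (M - j) *
            (ρ T * invPowSlope j x (Real.sqrt (T + c)))) =
        ∑ M ∈ Finset.range (B - 3 + 1), ∑ j ∈ Finset.range (M + 1),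
          K * γ M * (M.choose j : ℝ) * df j * H (M - j) *
            ∫ T in (1 : ℝ)..Ξ, ρ T * invPowSlope j x (Real.sqrt (T + c)) := by
      rw [intervalIntegral.integral_finsetSum fun M _ =>
        intervalIntegrable_fun_sum _ fun j _ => (hint j).const_mul _]
      refine Finset.sum_congr rfl fun M _ => ?_
      rw [intervalIntegral.integral_finsetSum fun j _ => (hint j).const_mul _]
      simp only [intervalIntegral.integral_const_mul]
    rw [hI, hGX]
    simp only [Finset.mul_sum, ← Finset.sum_add_distrib]
    refine Finset.sum_congr rfl fun M _ => Finset.sum_congr rfl fun j _ => ?_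
    have hkey := congrArg (K * γ M * (M.choose j : ℝ) * df j * H (M - j) * ·)
      (schwingerDyson_inv_pow hΞ.le hc hx hρ hρl j)
    simp only [Finset.mul_sum] at hkey
    rw [hW, ← hx_def]
    refine Eq.trans ?_ (hkey.trans (Finset.sum_congr rfl fun l _ => ?_))
    · ring
    · rw [hx2]
      ring
end
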